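/- Let m, l, C, n be integers with 1 ≤ l ≤ m/2, C ≥ 1, n ≥ 1. On a common finite probability space, let S_1, …, S_m be i.i.d. random variables with values in a finite set; let E¹ be an event independent of (S_1,…,S_m); let M be a random variable taking at most 2^C distinct values; let E² be an event with Pr[E² | E¹] ≥ 9/10; and for each Q ∈ [m] let B_Q, G_Q be {0,1}-valued random variables. Let ρ = (ρ_1,…,ρ_l) be a uniformly random injective sequence in [m] and J uniform on [l], with (ρ, J) independent of all of the above. Set Z := (M, ρ_{<J}, G_{ρ_{<J}}, B_{ρ_{<J}}, S_{ρ_{<J}}, J) and E := E¹ ∧ E², and suppose additionally that Pr[G_{ρ_J} = 0 | E] ≤ 10/n². Then E_{(z,q) ∼ (Z, ρ_J) | G_{ρ_J}=1, E}[ ∑_s | Pr[S_q = s | Z=z, ρ_J=q, G_{ρ_J}=1, E] − Pr[S_q = s] | ] ≤ 5·√((C+l)/m) + 200/n². -/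

import Mathlib

noncomputable section
open scoped Classical
open Finset

/-- Probability of an event under a probability mass function `p` on a finite sample space. -/
def prEvt {Ω : Type*} [Fintype Ω] (p : Ω → ℝ) (E : Set Ω) : ℝ :=
  ∑ ω, if ω ∈ E then p ω else 0

/-- Conditional probability of `E` given `F`. -/
def cprEvt {Ω : Type*} [Fintype Ω] (p : Ω → ℝ) (E F : Set Ω) : ℝ :=
  prEvt p (E ∩ F) / prEvt p F

/-- The random variable `Z := (M, ρ_{<J}, G_{ρ_{<J}}, B_{ρ_{<J}}, S_{ρ_{<J}}, J)`,
where "`<J`" prefixes are encoded as `Option`-valued tuples of length `l`. -/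
def Zvar {Ω α κ : Type*} {m l : ℕ} (S : Fin m → Ω → α) (M : Ω → κ)
    (B G : Fin m → Ω → Bool) (ρ : Ω → Fin l → Fin m) (J : Ω → Fin l) :
    Ω → κ × (Fin l → Option (Fin m)) × (Fin l → Option Bool) × (Fin l → Option Bool) ×
      (Fin l → Option α) × Fin l :=
  fun ω =>
    (M ω,
     fun i => if i < J ω then some (ρ ω i) else none,
     fun i => if i < J ω then some (G (ρ ω i) ω) else none,
     fun i => if i < J ω then some (B (ρ ω i) ω) else none,
     fun i => if i < J ω then some (S (ρ ω i) ω) else none,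
     J ω)


theorem sum_fiber {Ω β : Type*} [Fintype Ω] [Fintype β] (w : Ω → ℝ) (V : Ω → β) (F : β → ℝ) :
    ∑ ω, w ω * F (V ω) = ∑ v, (∑ ω, if V ω = v then w ω else 0) * F v := by
  simp_rw [Finset.sum_mul]
  rw [Finset.sum_comm]
  refine Finset.sum_congr rfl fun ω _ => ?_
  simp [ite_mul]

theorem indep_exp {Ω A β : Type*} [Fintype Ω] [Fintype A] [Fintype β] (p : Ω → ℝ)
    (X : Ω → A) (V : Ω → β)
    (h : ∀ a v, prEvt p {ω | X ω = a ∧ V ω = v} = prEvt p {ω | X ω = a} * prEvt p {ω | V ω = v})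
    (F : A → β → ℝ) :
    ∑ ω, p ω * F (X ω) (V ω) = ∑ a, prEvt p {ω | X ω = a} * ∑ ω, p ω * F a (V ω) := by
  have h1 := sum_fiber p (fun ω => (X ω, V ω)) (fun x => F x.1 x.2)
  simp only at h1
  rw [h1, Fintype.sum_prod_type]
  refine Finset.sum_congr rfl fun a _ => ?_
  rw [sum_fiber p V (F a), Finset.mul_sum]
  refine Finset.sum_congr rfl fun v _ => ?_
  have h2 := h a v
  simp only [prEvt, Set.mem_ofPred_eq] at h2 ⊢
  rw [← mul_assoc, ← h2]
  simp only [Prod.mk.injEq]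
  congr!

theorem mgf_bound {α : Type*} [Fintype α] (μ σ : α → ℝ) (hμ : ∀ x, 0 ≤ μ x) (h1 : ∑ x, μ x = 1)
    (hσ : ∀ x, |σ x| ≤ 1) (t : ℝ) (ht0 : 0 ≤ t) (ht : t ≤ 1 / 2) :
    ∑ x, μ x * Real.exp (t * (σ x - ∑ y, μ y * σ y)) ≤ Real.exp (t ^ 2) := by
  set c := ∑ y, μ y * σ y with hc
  have hcb : |c| ≤ 1 := by
    calc |c| ≤ ∑ y, |μ y * σ y| := Finset.abs_sum_le_sum_abs _ _
      _ ≤ ∑ y, μ y := Finset.sum_le_sum fun y _ => by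
          rw [abs_mul, abs_of_nonneg (hμ y)]
          exact mul_le_of_le_one_right (hμ y) (hσ y)
      _ = 1 := h1
  have hpt : ∀ x, μ x * Real.exp (t * (σ x - c)) ≤
      μ x * (1 - t * c + t ^ 2 * (1 + c ^ 2)) + (t - 2 * t ^ 2 * c) * (μ x * σ x) := by
    intro x
    have ha := abs_le.1 (hσ x)
    have hb := abs_le.1 hcb
    have hu : |t * (σ x - c)| ≤ 1 := by
      rw [abs_le]; constructor <;> nlinarith
    have := abs_le.1 (Real.abs_exp_sub_one_sub_id_le hu)
    have hs : σ x ^ 2 ≤ 1 := by nlinarith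
    have : Real.exp (t * (σ x - c)) ≤
      (1 - t * c + t ^ 2 * (1 + c ^ 2)) + (t - 2 * t ^ 2 * c) * σ x := by
      nlinarith [mul_le_mul_of_nonneg_left hs (sq_nonneg t)]
    nlinarith [mul_le_mul_of_nonneg_left this (hμ x)]
  calc _ ≤ ∑ x, (μ x * (1 - t * c + t ^ 2 * (1 + c ^ 2)) + (t - 2 * t ^ 2 * c) * (μ x * σ x)) :=
        Finset.sum_le_sum fun x _ => hpt x
    _ = (1 - t * c + t ^ 2 * (1 + c ^ 2)) + (t - 2 * t ^ 2 * c) * c := by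
        rw [Finset.sum_add_distrib, ← Finset.sum_mul, ← Finset.mul_sum, h1, ← hc, one_mul]
    _ ≤ t ^ 2 + 1 := by nlinarith [mul_nonneg (sq_nonneg t) (sq_nonneg c)]
    _ ≤ _ := Real.add_one_le_exp _

theorem prod_mgf {ι α : Type*} [Fintype ι] [Fintype α] (μ : ι → α → ℝ)
    (hμ : ∀ i x, 0 ≤ μ i x) (h1 : ∀ i, ∑ x, μ i x = 1) (R : ι → Prop)
    (H : (ι → α) → ι → α → ℝ)
    (hH : ∀ s s', (∀ i, R i → s i = s' i) → H s = H s')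
    (c : ℝ) (hc : ∀ s q, ∑ x, μ q x * Real.exp (H s q x) ≤ Real.exp c) :
    ∑ s : ι → α, (∏ i, μ i (s i)) *
      Real.exp (∑ q ∈ Finset.univ.filter (fun q => ¬ R q), H s q (s q)) ≤
    Real.exp ((Finset.univ.filter (fun q => ¬ R q)).card * c) := by
  let e := Equiv.piEquivPiSubtypeProd R (fun _ : ι => α)
  rw [← e.symm.sum_comp, Fintype.sum_prod_type]
  have hin : ∀ u : {i // R i} → α, 
      ∑ v : {i // ¬ R i} → α, (∏ i, μ i (e.symm (u, v) i)) *
        Real.exp (∑ q ∈ Finset.univ.filter (fun q => ¬ R q),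
          H (e.symm (u, v)) q (e.symm (u, v) q)) ≤
      (∏ i : {i // R i}, μ i (u i)) *
        Real.exp ((Finset.univ.filter (fun q => ¬ R q)).card * c) := by
    intro u
    by_cases hne : Nonempty ({i // ¬ R i} → α)
    swap
    · rw [not_nonempty_iff] at hne
      simp only [Finset.univ_eq_empty, Finset.sum_empty]
      exact mul_nonneg (Finset.prod_nonneg fun i _ => hμ _ _) (Real.exp_pos _).le
    obtain ⟨v0⟩ := hne
    have hterm : ∀ v : {i // ¬ R i} → α, (∏ i, μ i (e.symm (u, v) i)) *
        Real.exp (∑ q ∈ Finset.univ.filter (fun q => ¬ R q),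
          H (e.symm (u, v)) q (e.symm (u, v) q)) =
        (∏ i : {i // R i}, μ i (u i)) * ∏ q : {i // ¬ R i},
          (μ q (v q) * Real.exp (H (e.symm (u, v0)) q (v q))) := by
      intro v
      have hHv : H (e.symm (u, v)) = H (e.symm (u, v0)) := by
        apply hH
        intro i hi
        simp [e, Equiv.piEquivPiSubtypeProd, hi]
      rw [hHv, Real.exp_sum, Finset.prod_mul_distrib, ← mul_assoc]
      congr 1
      · rw [← Fintype.prod_subtype_mul_prod_subtype R]
        congr 1
        · refine Finset.prod_congr rfl fun i _ => ?_
          simp [e, Equiv.piEquivPiSubtypeProd, i.2]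
        · refine Finset.prod_congr rfl fun i _ => ?_
          simp [e, Equiv.piEquivPiSubtypeProd, i.2]
      · rw [Finset.prod_subtype (Finset.univ.filter (fun q => ¬ R q)) (p := fun q => ¬ R q)
          (by simp)]
        refine Finset.prod_congr rfl fun i _ => ?_
        simp [e, Equiv.piEquivPiSubtypeProd, i.2]
    simp_rw [hterm]
    rw [← Finset.mul_sum]
    refine mul_le_mul_of_nonneg_left ?_ (Finset.prod_nonneg fun i _ => hμ _ _)
    rw [← Fintype.prod_sum (fun (q : {i // ¬ R i}) x => μ q x * Real.exp (H (e.symm (u, v0)) q x))]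
    calc ∏ q : {i // ¬ R i}, ∑ x, μ q x * Real.exp (H (e.symm (u, v0)) q x)
        ≤ ∏ q : {i // ¬ R i}, Real.exp c :=
          Finset.prod_le_prod (fun q _ => Finset.sum_nonneg fun x _ =>
            mul_nonneg (hμ _ _) (Real.exp_pos _).le) (fun q _ => hc _ _)
      _ = _ := by
          rw [Finset.prod_const, ← Real.exp_nat_mul, Finset.card_univ, Fintype.card_subtype]
  calc _ ≤ ∑ u : {i // R i} → α, (∏ i : {i // R i}, μ i (u i)) *
        Real.exp ((Finset.univ.filter (fun q => ¬ R q)).card * c) :=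
        Finset.sum_le_sum fun u _ => hin u
    _ = _ := by
        rw [← Finset.sum_mul, ← Fintype.prod_sum (fun (q : {i // R i}) x => μ q x)]
        simp [h1]

theorem card_prefix_compl {m l : ℕ} (j : Fin l) : ∀ r : Fin l → Fin m, Function.Injective r →
      (Finset.univ.filter (fun q => ¬ ∃ i, i < j ∧ r i = q)).card = m - j := by
    intro r hr
    have : (Finset.univ.filter (fun q => ¬ ∃ i, i < j ∧ r i = q)) =
        ((Finset.univ.filter (fun i => i < j)).image r)ᶜ := by
      ext q; simp
    rw [this, Finset.card_compl, Finset.card_image_of_injective _ hr]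
    have h3 : (Finset.univ.filter (fun i : Fin l => i < j)) = Finset.Iio j := by
      ext i; simp
    rw [h3, Fin.card_Iio, Fintype.card_fin]

theorem exchange {m l : ℕ} (j : Fin l) (hjm : (j : ℕ) < m) (A : (Fin l → Fin m) → Fin m → ℝ)
    (hA : ∀ r r', (∀ i, i < j → r i = r' i) → A r = A r') (b : ℝ)
    (hb : ∀ r : Fin l → Fin m, Function.Injective r →
      ∑ q ∈ Finset.univ.filter (fun q => ¬ ∃ i, i < j ∧ r i = q), A r q ≤
        (Finset.univ.filter (fun q => ¬ ∃ i, i < j ∧ r i = q)).card * b) :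
    ∑ r ∈ Finset.univ.filter (fun r : Fin l → Fin m => Function.Injective r), A r (r j) ≤
      ∑ r ∈ Finset.univ.filter (fun r : Fin l → Fin m => Function.Injective r), b := by
  have hcard := card_prefix_compl (m := m) j
  have hpos : (0 : ℝ) < ((m - j : ℕ) : ℝ) := by
    have : 0 < m - (j : ℕ) := by omega
    exact_mod_cast this
  have key : ∑ r ∈ Finset.univ.filter (fun r : Fin l → Fin m => Function.Injective r),
        ∑ q ∈ Finset.univ.filter (fun q => ¬ ∃ i, i < j ∧ r i = q), A r (r j) =
      ∑ r ∈ Finset.univ.filter (fun r : Fin l → Fin m => Function.Injective r),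
        ∑ q ∈ Finset.univ.filter (fun q => ¬ ∃ i, i < j ∧ r i = q), A r q := by
    rw [Finset.sum_sigma', Finset.sum_sigma']
    have hsw : ∀ (r : Fin l → Fin m) (q : Fin m), Function.Injective r →
        (¬ ∃ i, i < j ∧ r i = q) → ∀ i, i < j → Equiv.swap (r j) q (r i) = r i := by
      intro r q hr hq i hi
      apply Equiv.swap_apply_of_ne_of_ne
      · intro h; exact hi.ne (hr h)
      · intro h; exact hq ⟨i, hi, h⟩
    let T : (Σ _ : Fin l → Fin m, Fin m) → (Σ _ : Fin l → Fin m, Fin m) :=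
      fun x => ⟨fun i => Equiv.swap (x.1 j) x.2 (x.1 i), x.1 j⟩
    have hTm : ∀ x ∈ (Finset.univ.filter (fun r : Fin l → Fin m => Function.Injective r)).sigma
        (fun r => Finset.univ.filter (fun q => ¬ ∃ i, i < j ∧ r i = q)),
        T x ∈ (Finset.univ.filter (fun r : Fin l → Fin m => Function.Injective r)).sigma
        (fun r => Finset.univ.filter (fun q => ¬ ∃ i, i < j ∧ r i = q)) := by
      rintro ⟨r, q⟩ hx
      simp only [Finset.mem_sigma, Finset.mem_filter, Finset.mem_univ, true_and] at hx ⊢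
      obtain ⟨hr, hq⟩ := hx
      refine ⟨(Equiv.injective _).comp hr, ?_⟩
      rintro ⟨i, hi, h⟩
      simp only [T] at h
      rw [hsw r q hr hq i hi] at h
      exact hi.ne (hr h)
    have hTT : ∀ x, T (T x) = x := by
      rintro ⟨r, q⟩
      simp only [T, Equiv.swap_apply_left]
      congr 1
      funext i
      rw [Equiv.swap_comm q, Equiv.swap_apply_self]
    refine Finset.sum_nbij' T T hTm hTm (fun x _ => hTT x) (fun x _ => hTT x) ?_
    rintro ⟨r, q⟩ hx
    simp only [Finset.mem_sigma, Finset.mem_filter, Finset.mem_univ, true_and] at hx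
    obtain ⟨hr, hq⟩ := hx
    simp only [T]
    rw [hA _ r (fun i hi => hsw r q hr hq i hi)]
  have h2 : ∑ r ∈ Finset.univ.filter (fun r : Fin l → Fin m => Function.Injective r),
        ((m - j : ℕ) : ℝ) * A r (r j) ≤
      ∑ r ∈ Finset.univ.filter (fun r : Fin l → Fin m => Function.Injective r),
        ((m - j : ℕ) : ℝ) * b := by
    calc _ = ∑ r ∈ Finset.univ.filter (fun r : Fin l → Fin m => Function.Injective r),
        ∑ q ∈ Finset.univ.filter (fun q => ¬ ∃ i, i < j ∧ r i = q), A r (r j) := by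
          refine Finset.sum_congr rfl fun r hr => ?_
          rw [Finset.sum_const, hcard r (by simpa using hr), nsmul_eq_mul]
      _ = _ := key
      _ ≤ _ := Finset.sum_le_sum fun r hr => by
          have hr' : Function.Injective r := by simpa using hr
          have := hb r hr'
          rwa [hcard r hr'] at this
  rw [← Finset.mul_sum, ← Finset.mul_sum] at h2
  exact le_of_mul_le_mul_left h2 hpos

/-- The value of `Z` for a fixed sequence and index, as a function of the side information. -/
def Zof {α κ : Type*} {m l : ℕ} (r : Fin l → Fin m) (j : Fin l) (k : κ) (g b : Fin l → Bool)
    (s : Fin l → α) : κ × (Fin l → Option (Fin m)) × (Fin l → Option Bool) ×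
      (Fin l → Option Bool) × (Fin l → Option α) × Fin l :=
  (k, fun i => if i < j then some (r i) else none,
    fun i => if i < j then some (g i) else none,
    fun i => if i < j then some (b i) else none,
    fun i => if i < j then some (s i) else none, j)

/-- Centered test function. -/
def cent {ι α ζ : Type*} [Fintype α] (μ : ι → α → ℝ) (σ : ζ → ι → α → ℝ) (z : ζ) (q : ι) (x : α) :
    ℝ := σ z q x - ∑ y, μ q y * σ z q y

theorem core {Ω α κ : Type*} [Fintype Ω] [Fintype α] [Fintype κ]
    (p : Ω → ℝ) (hp : ∀ ω, 0 ≤ p ω) (m l C : ℕ) (hC : 1 ≤ C) (S : Fin m → Ω → α)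
    (μ : Fin m → α → ℝ) (hμ : ∀ i x, 0 ≤ μ i x) (hμ1 : ∀ i, ∑ x, μ i x = 1)
    (E1 : Set Ω)
    (hE1 : ∀ f : Fin m → α, prEvt p (E1 ∩ {ω | ∀ i, S i ω = f i}) =
        prEvt p E1 * ∏ i, μ i (f i))
    (M : Ω → κ)
    (hM : (Finset.univ.filter fun k : κ => prEvt p {ω | M ω = k} ≠ 0).card ≤ 2 ^ C)
    (E2 : Set Ω) (hE : prEvt p E1 ≤ 10 / 9 * prEvt p (E1 ∩ E2))
    (B G : Fin m → Ω → Bool) (r : Fin l → Fin m) (j : Fin l)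
    (σ : (κ × (Fin l → Option (Fin m)) × (Fin l → Option Bool) ×
      (Fin l → Option Bool) × (Fin l → Option α) × Fin l) → Fin m → α → ℝ)
    (hσ : ∀ z q x, |σ z q x| ≤ 1) (t : ℝ) (ht0 : 0 ≤ t) (ht : t ≤ 1 / 2) :
    t * ∑ q ∈ Finset.univ.filter (fun q => ¬ ∃ i, i < j ∧ r i = q),
      ∑ ω, (if ω ∈ E1 ∩ E2 then p ω else 0) *
        cent μ σ (Zof r j (M ω) (fun i => G (r i) ω) (fun i => B (r i) ω) (fun i => S (r i) ω)) q
          (S q ω) ≤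
    prEvt p (E1 ∩ E2) * (((C : ℝ) + l) * Real.log 4 +
      (Finset.univ.filter (fun q => ¬ ∃ i, i < j ∧ r i = q)).card * t ^ 2) := by
  set Q := Finset.univ.filter (fun q => ¬ ∃ i, i < j ∧ r i = q) with hQ
  set e := prEvt p (E1 ∩ E2) with he
  set lam : ℝ := ((C : ℝ) + l) * Real.log 4 + Q.card * t ^ 2 with hlam
  let w : Ω → ℝ := fun ω => if ω ∈ E1 ∩ E2 then p ω else 0
  have hw : ∀ ω, 0 ≤ w ω := fun ω => by
    simp only [w]; split_ifs <;> simp [hp]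
  have hwe : ∑ ω, w ω = e := by
    simp only [w, he, prEvt]
    congr!
  have he0 : 0 ≤ e := hwe ▸ Finset.sum_nonneg fun ω _ => hw ω
  let ft : κ × (Fin l → Bool) × (Fin l → Bool) → (Fin m → α) → ℝ := fun a s =>
    ∑ q ∈ Q, t * cent μ σ (Zof r j a.1 a.2.1 a.2.2 (fun i => s (r i))) q (s q)
  let a : Ω → κ × (Fin l → Bool) × (Fin l → Bool) := fun ω =>
    (M ω, fun i => G (r i) ω, fun i => B (r i) ω)
  let AA : Finset (κ × (Fin l → Bool) × (Fin l → Bool)) :=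
    (Finset.univ.filter fun k : κ => prEvt p {ω | M ω = k} ≠ 0) ×ˢ Finset.univ
  have hAA : (AA.card : ℝ) ≤ 2 ^ C * 4 ^ l := by
    have : AA.card ≤ 2 ^ C * 4 ^ l := by
      simp only [AA, Finset.card_product, Finset.card_univ, Fintype.card_prod, Fintype.card_fun,
        Fintype.card_bool, Fintype.card_fin]
      rw [← mul_pow]
      exact Nat.mul_le_mul_right _ hM
    exact_mod_cast this
  -- moment generating function for a fixed value of the side information
  have hmgf : ∀ a, ∑ s : Fin m → α, (∏ i, μ i (s i)) * Real.exp (ft a s) ≤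
      Real.exp (Q.card * t ^ 2) := by
    intro a
    have key := prod_mgf μ hμ hμ1 (fun q => ∃ i, i < j ∧ r i = q)
      (fun s q x => t * cent μ σ (Zof r j a.1 a.2.1 a.2.2 (fun i => s (r i))) q x) ?_ (t ^ 2) ?_
    · convert key
    · intro s s' hs
      have : Zof r j a.1 a.2.1 a.2.2 (fun i => s (r i)) =
          Zof r j a.1 a.2.1 a.2.2 (fun i => s' (r i)) := by
        simp only [Zof]
        congr 5
        funext i
        split_ifs with hi
        · rw [hs (r i) ⟨i, hi, rfl⟩]
        · rfl
      simp only [this]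
    · intro s q
      exact mgf_bound (μ q) _ (hμ q) (hμ1 q) (hσ _ q) t ht0 ht
  have hfix : ∀ a, ∑ ω, w ω * Real.exp (ft a (fun i => S i ω)) ≤
      10 / 9 * e * Real.exp (Q.card * t ^ 2) := by
    intro a
    calc ∑ ω, w ω * Real.exp (ft a (fun i => S i ω))
        ≤ ∑ ω, (if ω ∈ E1 then p ω else 0) * Real.exp (ft a (fun i => S i ω)) := by
          refine Finset.sum_le_sum fun ω _ => mul_le_mul_of_nonneg_right ?_ (Real.exp_pos _).le
          by_cases h1 : ω ∈ E1 <;> by_cases h2 : ω ∈ E2 <;> simp [w, h1, h2, hp]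
      _ = prEvt p E1 * ∑ s : Fin m → α, (∏ i, μ i (s i)) * Real.exp (ft a s) := by
          rw [sum_fiber (fun ω => if ω ∈ E1 then p ω else 0) (fun ω i => S i ω)
            (fun s => Real.exp (ft a s)), Finset.mul_sum]
          refine Finset.sum_congr rfl fun s _ => ?_
          rw [← mul_assoc, ← hE1 s]
          congr 1
          refine Finset.sum_congr rfl fun ω _ => ?_
          by_cases h1 : ω ∈ E1 <;> simp [h1, funext_iff]
      _ ≤ 10 / 9 * e * Real.exp (Q.card * t ^ 2) := by
          refine mul_le_mul hE (hmgf a) ?_ (by positivity)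
          exact Finset.sum_nonneg fun s _ =>
            mul_nonneg (Finset.prod_nonneg fun i _ => hμ _ _) (Real.exp_pos _).le
  have hexp : ∑ ω, w ω * Real.exp (ft (a ω) (fun i => S i ω)) ≤ e * Real.exp lam := by
    calc ∑ ω, w ω * Real.exp (ft (a ω) (fun i => S i ω))
        ≤ ∑ ω, ∑ b ∈ AA, w ω * Real.exp (ft b (fun i => S i ω)) := by
          refine Finset.sum_le_sum fun ω _ => ?_
          by_cases h0 : p ω = 0
          · have : w ω = 0 := by simp [w, h0]
            simp [this]
          · refine Finset.single_le_sum (f := fun b => w ω * Real.exp (ft b (fun i => S i ω)))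
              (fun b _ => mul_nonneg (hw ω) (Real.exp_pos _).le) ?_
            simp only [AA, Finset.mem_product, Finset.mem_filter, Finset.mem_univ, true_and,
              and_true, a]
            have hpos : 0 < p ω := lt_of_le_of_ne (hp ω) (Ne.symm h0)
            refine ne_of_gt (lt_of_lt_of_le hpos ?_)
            have := Finset.single_le_sum (f := fun ω' => if ω' ∈ {ω' | M ω' = M ω} then p ω' else 0)
              (fun ω' _ => by split_ifs <;> simp [hp]) (Finset.mem_univ ω)
            simpa [prEvt] using this
      _ = ∑ b ∈ AA, ∑ ω, w ω * Real.exp (ft b (fun i => S i ω)) := Finset.sum_comm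
      _ ≤ ∑ b ∈ AA, 10 / 9 * e * Real.exp (Q.card * t ^ 2) :=
          Finset.sum_le_sum fun b _ => hfix b
      _ = AA.card * (10 / 9 * e * Real.exp (Q.card * t ^ 2)) := by
          rw [Finset.sum_const, nsmul_eq_mul]
      _ ≤ (2 ^ C * 4 ^ l) * (10 / 9 * e * Real.exp (Q.card * t ^ 2)) :=
          mul_le_mul_of_nonneg_right hAA (by positivity)
      _ = (10 / 9 * 2 ^ C) * (4 ^ l * (e * Real.exp (Q.card * t ^ 2))) := by ring
      _ ≤ (4 ^ C) * (4 ^ l * (e * Real.exp (Q.card * t ^ 2))) := by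
          refine mul_le_mul_of_nonneg_right ?_ (by positivity)
          have h2 : (2 : ℝ) ≤ 2 ^ C := by
            calc (2 : ℝ) = 2 ^ 1 := by norm_num
              _ ≤ 2 ^ C := pow_le_pow_right₀ (by norm_num) hC
          have h4 : (4 : ℝ) ^ C = 2 ^ C * 2 ^ C := by rw [← mul_pow]; norm_num
          rw [h4]
          nlinarith
      _ = e * Real.exp lam := by
          have h4 : Real.exp (((C : ℝ) + l) * Real.log 4) = 4 ^ C * 4 ^ l := by
            rw [← pow_add, ← Nat.cast_add, Real.exp_nat_mul, Real.exp_log (by norm_num)]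
          rw [hlam, Real.exp_add, h4]; ring
  have hlin : t * ∑ q ∈ Q, ∑ ω, w ω *
        cent μ σ (Zof r j (M ω) (fun i => G (r i) ω) (fun i => B (r i) ω) (fun i => S (r i) ω)) q
          (S q ω) = ∑ ω, w ω * ft (a ω) (fun i => S i ω) := by
    rw [Finset.sum_comm, Finset.mul_sum]
    refine Finset.sum_congr rfl fun ω _ => ?_
    simp only [ft, a, Finset.mul_sum]
    refine Finset.sum_congr rfl fun q _ => ?_
    ring
  have hfin : ∑ ω, w ω * ft (a ω) (fun i => S i ω) ≤ e * lam := by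
    calc ∑ ω, w ω * ft (a ω) (fun i => S i ω)
        ≤ ∑ ω, (w ω * (lam - 1) +
            Real.exp (-lam) * (w ω * Real.exp (ft (a ω) (fun i => S i ω)))) := by
          refine Finset.sum_le_sum fun ω _ => ?_
          have h1 := Real.add_one_le_exp (ft (a ω) (fun i => S i ω) - lam)
          rw [sub_eq_neg_add, Real.exp_add] at h1
          nlinarith [mul_le_mul_of_nonneg_left h1 (hw ω)]
      _ = e * (lam - 1) +
          Real.exp (-lam) * ∑ ω, w ω * Real.exp (ft (a ω) (fun i => S i ω)) := by
          rw [Finset.sum_add_distrib, ← Finset.sum_mul, ← Finset.mul_sum, hwe]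
      _ ≤ e * (lam - 1) + Real.exp (-lam) * (e * Real.exp lam) := by
          have := mul_le_mul_of_nonneg_left hexp (Real.exp_pos (-lam)).le
          linarith
      _ = e * lam := by
          have : Real.exp (-lam) * Real.exp lam = 1 := by rw [← Real.exp_add]; simp
          linear_combination e * this
  calc _ = ∑ ω, w ω * ft (a ω) (fun i => S i ω) := hlin
    _ ≤ _ := hfin

theorem prEvt_nonneg {Ω : Type*} [Fintype Ω] (p : Ω → ℝ) (hp : ∀ ω, 0 ≤ p ω) (E : Set Ω) :
    0 ≤ prEvt p E := Finset.sum_nonneg fun ω _ => by split_ifs <;> simp [hp]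

theorem prEvt_mono {Ω : Type*} [Fintype Ω] (p : Ω → ℝ) (hp : ∀ ω, 0 ≤ p ω) {E F : Set Ω}
    (h : E ⊆ F) : prEvt p E ≤ prEvt p F := Finset.sum_le_sum fun ω _ => by
  by_cases h1 : ω ∈ E
  · simp [h1, h h1]
  · simp only [h1, if_false]; split_ifs <;> simp [hp]

theorem prEvt_sum_fiber {Ω α : Type*} [Fintype Ω] [Fintype α] (p : Ω → ℝ) (X : Ω → α) (E : Set Ω) :
    ∑ x, prEvt p ({ω | X ω = x} ∩ E) = prEvt p E := by
  simp only [prEvt]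
  rw [Finset.sum_comm]
  refine Finset.sum_congr rfl fun ω _ => ?_
  by_cases h : ω ∈ E <;> simp [h]

theorem stepA {Ω ζ ι α : Type*} [Fintype Ω] [Fintype ζ] [Fintype ι] [Fintype α]
    (p : Ω → ℝ) (hp : ∀ ω, 0 ≤ p ω) (Zv : Ω → ζ) (Qv : Ω → ι) (S : ι → Ω → α)
    (μ : ι → α → ℝ) (K : Set Ω) (hg : 0 < prEvt p K) :
    ∃ σ : ζ → ι → α → ℝ, (∀ z q x, |σ z q x| ≤ 1) ∧
      (∑ z, ∑ q, cprEvt p ({ω | Zv ω = z} ∩ {ω | Qv ω = q}) K *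
        ∑ x, |cprEvt p {ω | S q ω = x} ({ω | Zv ω = z} ∩ {ω | Qv ω = q} ∩ K) - μ q x|) *
        prEvt p K = ∑ ω, (if ω ∈ K then p ω else 0) * cent μ σ (Zv ω) (Qv ω) (S (Qv ω) ω) := by
  let nn : ζ → ι → α → ℝ := fun z q x =>
    prEvt p ({ω | S q ω = x} ∩ ({ω | Zv ω = z} ∩ {ω | Qv ω = q} ∩ K))
  let dd : ζ → ι → ℝ := fun z q => prEvt p ({ω | Zv ω = z} ∩ {ω | Qv ω = q} ∩ K)
  let σ : ζ → ι → α → ℝ := fun z q x => if 0 ≤ nn z q x / dd z q - μ q x then 1 else -1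
  refine ⟨σ, ?_, ?_⟩
  · intro z q x
    simp only [σ]
    split_ifs <;> simp
  have hsum : ∀ z q, ∑ x, nn z q x = dd z q := fun z q => prEvt_sum_fiber p (S q) _
  have hn0 : ∀ z q x, 0 ≤ nn z q x := fun z q x => prEvt_nonneg p hp _
  have hle : ∀ z q x, nn z q x ≤ dd z q := fun z q x => prEvt_mono p hp Set.inter_subset_right
  have hR := sum_fiber (fun ω => if ω ∈ K then p ω else 0)
    (fun ω => (Zv ω, Qv ω, S (Qv ω) ω)) (fun v => cent μ σ v.1 v.2.1 v.2.2)
  simp only at hR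
  rw [hR, Fintype.sum_prod_type, Finset.sum_mul]
  refine Finset.sum_congr rfl fun z _ => ?_
  rw [Fintype.sum_prod_type, Finset.sum_mul]
  refine Finset.sum_congr rfl fun q _ => ?_
  have hnn : ∀ x, (∑ ω, if (Zv ω, Qv ω, S (Qv ω) ω) = (z, q, x) then
      (if ω ∈ K then p ω else 0) else 0) = nn z q x := by
    intro x
    simp only [nn, prEvt]
    refine Finset.sum_congr rfl fun ω _ => ?_
    by_cases h1 : Zv ω = z
    · by_cases h2 : Qv ω = q
      · subst h2
        by_cases h3 : S (Qv ω) ω = x <;> by_cases h4 : ω ∈ K <;> simp [h1, h3, h4]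
      · simp [h2]
    · simp [h1]
  have h1 : cprEvt p ({ω | Zv ω = z} ∩ {ω | Qv ω = q}) K * prEvt p K = dd z q := by
    simp only [cprEvt, dd]
    field_simp
  have h2 : ∀ x, dd z q * |nn z q x / dd z q - μ q x| = σ z q x * (nn z q x - dd z q * μ q x) := by
    intro x
    have hd0 : 0 ≤ dd z q := (hn0 z q x).trans (hle z q x)
    have h3 : nn z q x = dd z q * (nn z q x / dd z q) := by
      by_cases hd : dd z q = 0
      · have := hle z q x
        have := hn0 z q x
        rw [hd]; simp; linarith
      · field_simp
    have h4 : nn z q x - dd z q * μ q x = dd z q * (nn z q x / dd z q - μ q x) := by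
      linear_combination h3
    rw [h4]
    simp only [σ]
    split_ifs with h
    · rw [abs_of_nonneg h]; ring
    · rw [abs_of_neg (not_le.1 h)]; ring
  calc _ = (cprEvt p ({ω | Zv ω = z} ∩ {ω | Qv ω = q}) K * prEvt p K) *
        ∑ x, |nn z q x / dd z q - μ q x| := by
        simp only [nn, dd, cprEvt]; ring
    _ = ∑ x, σ z q x * (nn z q x - dd z q * μ q x) := by
        rw [h1, Finset.mul_sum]
        exact Finset.sum_congr rfl fun x _ => h2 x
    _ = ∑ x, nn z q x * cent μ σ z q x := by
        simp only [cent, mul_sub, Finset.sum_sub_distrib]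
        rw [← Finset.sum_mul, hsum, Finset.mul_sum]
        congr 1
        · exact Finset.sum_congr rfl fun x _ => by ring
        · exact Finset.sum_congr rfl fun x _ => by ring
    _ = _ := by
        refine Finset.sum_congr rfl fun x _ => ?_
        rw [← hnn x]
        congr!

theorem abs_cent_le {ι α ζ : Type*} [Fintype α] (μ : ι → α → ℝ) (hμ : ∀ i x, 0 ≤ μ i x)
    (hμ1 : ∀ i, ∑ x, μ i x = 1) (σ : ζ → ι → α → ℝ) (hσ : ∀ z q x, |σ z q x| ≤ 1)
    (z : ζ) (q : ι) (x : α) : |cent μ σ z q x| ≤ 2 := by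
  have h1 : |∑ y, μ q y * σ z q y| ≤ 1 := by
    calc |∑ y, μ q y * σ z q y| ≤ ∑ y, |μ q y * σ z q y| := Finset.abs_sum_le_sum_abs _ _
      _ ≤ ∑ y, μ q y := Finset.sum_le_sum fun y _ => by
          rw [abs_mul, abs_of_nonneg (hμ q y)]
          exact mul_le_of_le_one_right (hμ q y) (hσ _ _ y)
      _ = 1 := hμ1 q
  have h2 := abs_le.1 (hσ z q x)
  have h3 := abs_le.1 h1
  simp only [cent]
  rw [abs_le]; constructor <;> linarith

theorem stepB {Ω α κ : Type*} [Fintype Ω] [Fintype α] [Fintype κ]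
    (p : Ω → ℝ) (hp : ∀ ω, 0 ≤ p ω) (hsum : ∑ ω, p ω = 1)
    (m l C : ℕ) (hl1 : 1 ≤ l) (hlm : 2 * l ≤ m) (hC : 1 ≤ C) (S : Fin m → Ω → α)
    (μ : Fin m → α → ℝ) (hμ : ∀ i x, 0 ≤ μ i x) (hμ1 : ∀ i, ∑ x, μ i x = 1)
    (E1 : Set Ω)
    (hE1 : ∀ f : Fin m → α, prEvt p (E1 ∩ {ω | ∀ i, S i ω = f i}) =
        prEvt p E1 * ∏ i, μ i (f i))
    (M : Ω → κ)
    (hM : (Finset.univ.filter fun k : κ => prEvt p {ω | M ω = k} ≠ 0).card ≤ 2 ^ C)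
    (E2 : Set Ω) (hE : prEvt p E1 ≤ 10 / 9 * prEvt p (E1 ∩ E2))
    (B G : Fin m → Ω → Bool)
    (ρ : Ω → Fin l → Fin m) (J : Ω → Fin l)
    (hρinj : ∀ ω, Function.Injective (ρ ω)) (c : ℝ)
    (hρJunif : ∀ r : Fin l → Fin m, Function.Injective r → ∀ j : Fin l,
      prEvt p {ω | ρ ω = r ∧ J ω = j} = c)
    (hρJindep : ∀ (r : Fin l → Fin m) (j : Fin l)
        (v : (Fin m → α) × Bool × κ × Bool × (Fin m → Bool) × (Fin m → Bool)),
      prEvt p {ω | ρ ω = r ∧ J ω = j ∧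
          ((fun i => S i ω), (if ω ∈ E1 then true else false), M ω,
            (if ω ∈ E2 then true else false), (fun i => B i ω), (fun i => G i ω)) = v} =
        prEvt p {ω | ρ ω = r ∧ J ω = j} *
          prEvt p {ω | ((fun i => S i ω), (if ω ∈ E1 then true else false), M ω,
            (if ω ∈ E2 then true else false), (fun i => B i ω), (fun i => G i ω)) = v})
    (σ : (κ × (Fin l → Option (Fin m)) × (Fin l → Option Bool) ×
      (Fin l → Option Bool) × (Fin l → Option α) × Fin l) → Fin m → α → ℝ)
    (hσ : ∀ z q x, |σ z q x| ≤ 1) (y : ℝ) (hy0 : 0 < y) (hy : y ≤ 1 / 2)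
    (hy2 : y ^ 2 * m = (C : ℝ) + l) :
    ∑ ω, (if ω ∈ E1 ∩ E2 then p ω else 0) *
        cent μ σ (Zvar S M B G ρ J ω) (ρ ω (J ω)) (S (ρ ω (J ω)) ω) ≤
      prEvt p (E1 ∩ E2) * ((2 * Real.log 4 + 1) * y) := by
  set e := prEvt p (E1 ∩ E2) with he
  have he0 : 0 ≤ e := prEvt_nonneg p hp _
  set b : ℝ := e * ((2 * Real.log 4 + 1) * y) with hb
  let A : Fin l → (Fin l → Fin m) → Fin m → ℝ := fun j r q =>
    ∑ ω, (if ω ∈ E1 ∩ E2 then p ω else 0) *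
        cent μ σ (Zof r j (M ω) (fun i => G (r i) ω) (fun i => B (r i) ω) (fun i => S (r i) ω)) q
          (S q ω)
  let V : Ω → (Fin m → α) × Bool × κ × Bool × (Fin m → Bool) × (Fin m → Bool) := fun ω =>
    ((fun i => S i ω), (if ω ∈ E1 then true else false), M ω,
            (if ω ∈ E2 then true else false), (fun i => B i ω), (fun i => G i ω))
  let F : ((Fin l → Fin m) × Fin l) →
      ((Fin m → α) × Bool × κ × Bool × (Fin m → Bool) × (Fin m → Bool)) → ℝ := fun x v =>
    (if v.2.1 = true ∧ v.2.2.2.1 = true then 1 else 0) *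
      cent μ σ (Zof x.1 x.2 v.2.2.1 (fun i => v.2.2.2.2.2 (x.1 i))
        (fun i => v.2.2.2.2.1 (x.1 i)) (fun i => v.1 (x.1 i))) (x.1 x.2) (v.1 (x.1 x.2))
  have hF : ∀ x ω, p ω * F x (V ω) = (if ω ∈ E1 ∩ E2 then p ω else 0) *
      cent μ σ (Zof x.1 x.2 (M ω) (fun i => G (x.1 i) ω) (fun i => B (x.1 i) ω)
        (fun i => S (x.1 i) ω)) (x.1 x.2) (S (x.1 x.2) ω) := by
    intro x ω
    by_cases h1 : ω ∈ E1 <;> by_cases h2 : ω ∈ E2 <;> simp [F, V, h1, h2]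
  have hpair : ∀ r j, prEvt p {ω | (ρ ω, J ω) = (r, j)} = prEvt p {ω | ρ ω = r ∧ J ω = j} := by
    intro r j; simp only [Prod.mk.injEq]
  have hind := indep_exp p (fun ω => (ρ ω, J ω)) V (by
    rintro ⟨r, j⟩ v
    rw [hpair, ← hρJindep r j v]
    simp only [Prod.mk.injEq, V, and_assoc]) F
  have hL : ∑ ω, (if ω ∈ E1 ∩ E2 then p ω else 0) *
        cent μ σ (Zvar S M B G ρ J ω) (ρ ω (J ω)) (S (ρ ω (J ω)) ω) =
      ∑ ω, p ω * F (ρ ω, J ω) (V ω) :=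
    Finset.sum_congr rfl fun ω _ => by rw [hF]; rfl
  have hnoninj : ∀ r j, ¬ Function.Injective r → prEvt p {ω | ρ ω = r ∧ J ω = j} = 0 := by
    intro r j hr
    refine Finset.sum_eq_zero fun ω _ => ?_
    rw [if_neg]
    rintro ⟨h, -⟩
    exact hr (h ▸ hρinj ω)
  have hm : 0 < m := by omega
  have hl : Nonempty (Fin l) := ⟨⟨0, by omega⟩⟩
  have hPsum : ∀ (Φ : Fin l → (Fin l → Fin m) → ℝ),
      ∑ x : (Fin l → Fin m) × Fin l, prEvt p {ω | (ρ ω, J ω) = x} * Φ x.2 x.1 =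
      ∑ j, c * ∑ r ∈ Finset.univ.filter (fun r : Fin l → Fin m => Function.Injective r), Φ j r := by
    intro Φ
    rw [Fintype.sum_prod_type, Finset.sum_comm]
    refine Finset.sum_congr rfl fun j _ => ?_
    rw [Finset.mul_sum, Finset.sum_filter]
    refine Finset.sum_congr rfl fun r _ => ?_
    rw [hpair]
    split_ifs with hr
    · rw [hρJunif r hr]
    · rw [hnoninj r j hr, zero_mul]
  have hc : 0 ≤ c := by
    have hr : Function.Injective (Fin.castLE (show l ≤ m by omega)) :=
      Fin.castLE_injective _
    rw [← hρJunif _ hr hl.some]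
    exact prEvt_nonneg p hp _
  have hone : ∑ x : (Fin l → Fin m) × Fin l, prEvt p {ω | (ρ ω, J ω) = x} = 1 := by
    have := prEvt_sum_fiber p (fun ω => (ρ ω, J ω)) Set.univ
    simp only [Set.inter_univ] at this
    rw [this]
    simp [prEvt, hsum]
  have hex : ∀ j, ∑ r ∈ Finset.univ.filter (fun r : Fin l → Fin m => Function.Injective r),
      A j r (r j) ≤
      ∑ r ∈ Finset.univ.filter (fun r : Fin l → Fin m => Function.Injective r), b := by
    intro j
    have hj := j.2
    refine exchange j (by omega) (A j) ?_ b ?_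
    · intro r r' hrr
      funext q
      simp only [A]
      refine Finset.sum_congr rfl fun ω _ => ?_
      congr 2
      simp only [Zof]
      congr 1
      refine Prod.ext_iff.2 ⟨?_, Prod.ext_iff.2 ⟨?_, Prod.ext_iff.2 ⟨?_, Prod.ext_iff.2 ⟨?_, rfl⟩⟩⟩⟩ <;>
      · funext i
        by_cases hi : i < j
        · simp only [hi, if_true, hrr i hi]
        · simp only [hi, if_false]
    · intro r hr
      have h1 := core p hp m l C hC S μ hμ hμ1 E1 hE1 M hM E2 hE B G r j σ hσ y hy0.le hy
      have hcard := card_prefix_compl (m := m) j r hr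
      set k := (Finset.univ.filter (fun q => ¬ ∃ i, i < j ∧ r i = q)).card with hk
      have hmk : (m : ℝ) ≤ 2 * k := by
        have : m ≤ 2 * k := by omega
        exact_mod_cast this
      have hlog : 0 ≤ Real.log 4 := Real.log_nonneg (by norm_num)
      refine le_of_mul_le_mul_left (h1.trans ?_) hy0
      rw [← hy2, hb]
      have : y ^ 2 * m * Real.log 4 + k * y ^ 2 ≤ y * (k * ((2 * Real.log 4 + 1) * y)) := by
        nlinarith [mul_le_mul_of_nonneg_left hmk (mul_nonneg (sq_nonneg y) hlog)]
      calc _ ≤ e * (y * (k * ((2 * Real.log 4 + 1) * y))) := mul_le_mul_of_nonneg_left this he0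
        _ = _ := by ring
  calc _ = ∑ x : (Fin l → Fin m) × Fin l, prEvt p {ω | (ρ ω, J ω) = x} * A x.2 x.1 (x.1 x.2) := by
        rw [hL, hind]
        refine Finset.sum_congr rfl fun x _ => ?_
        simp only [hF, A]
    _ = ∑ j, c * ∑ r ∈ Finset.univ.filter (fun r : Fin l → Fin m => Function.Injective r),
          A j r (r j) := hPsum (fun j r => A j r (r j))
    _ ≤ ∑ j, c * ∑ r ∈ Finset.univ.filter (fun r : Fin l → Fin m => Function.Injective r), b :=
        Finset.sum_le_sum fun j _ => mul_le_mul_of_nonneg_left (hex j) hc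
    _ = ∑ x : (Fin l → Fin m) × Fin l, prEvt p {ω | (ρ ω, J ω) = x} * b :=
        (hPsum (fun _ _ => b)).symm
    _ = b := by rw [← Finset.sum_mul, hone, one_mul]

set_option maxHeartbeats 1000000

/-- Low information on `S_{ρ_J}` in L1 distance:
`E_{(z,q)∼(Z,ρ_J)|G_{ρ_J}=1,E}[ ‖law(S_q | Z=z, ρ_J=q, G_{ρ_J}=1, E) − law(S_q)‖₁ ]
  ≤ 5·√((C+l)/m) + 200/n²`. -/
theorem stmt14 {Ω α κ : Type*} [Fintype Ω] [Fintype α] [Fintype κ]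
    (p : Ω → ℝ) (hp : ∀ ω, 0 ≤ p ω) (hsum : ∑ ω, p ω = 1)
    (m l C n : ℕ) (hl1 : 1 ≤ l) (hlm : 2 * l ≤ m) (hC : 1 ≤ C) (hn : 1 ≤ n)
    (S : Fin m → Ω → α)
    -- the `S_i` are independent …
    (hSindep : ∀ f : Fin m → α,
      prEvt p {ω | ∀ i, S i ω = f i} = ∏ i, prEvt p {ω | S i ω = f i})
    -- … and identically distributed
    (hSident : ∀ (i j : Fin m) (x : α),
      prEvt p {ω | S i ω = x} = prEvt p {ω | S j ω = x})
    (E1 : Set Ω)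
    -- `E¹` is independent of `(S_1,…,S_m)`
    (hE1indep : ∀ f : Fin m → α,
      prEvt p (E1 ∩ {ω | ∀ i, S i ω = f i}) =
        prEvt p E1 * prEvt p {ω | ∀ i, S i ω = f i})
    (M : Ω → κ)
    -- `M` takes at most `2^C` distinct values
    (hM : (Finset.univ.filter fun k : κ => prEvt p {ω | M ω = k} ≠ 0).card ≤ 2 ^ C)
    (E2 : Set Ω) (hE2 : 9 / 10 ≤ cprEvt p E2 E1)
    (B G : Fin m → Ω → Bool)
    (ρ : Ω → Fin l → Fin m) (J : Ω → Fin l)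
    -- `ρ` is a uniformly random injective sequence, `J` uniform on `[l]`
    (hρinj : ∀ ω, Function.Injective (ρ ω))
    (hρJunif : ∀ r : Fin l → Fin m, Function.Injective r → ∀ j : Fin l,
      prEvt p {ω | ρ ω = r ∧ J ω = j} = ((m.descFactorial l : ℝ) * l)⁻¹)
    -- `(ρ, J)` is independent of all of the above
    (hρJindep : ∀ (r : Fin l → Fin m) (j : Fin l)
        (v : (Fin m → α) × Bool × κ × Bool × (Fin m → Bool) × (Fin m → Bool)),
      prEvt p {ω | ρ ω = r ∧ J ω = j ∧
          ((fun i => S i ω), (if ω ∈ E1 then true else false), M ω,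
            (if ω ∈ E2 then true else false), (fun i => B i ω), (fun i => G i ω)) = v} =
        prEvt p {ω | ρ ω = r ∧ J ω = j} *
          prEvt p {ω | ((fun i => S i ω), (if ω ∈ E1 then true else false), M ω,
            (if ω ∈ E2 then true else false), (fun i => B i ω), (fun i => G i ω)) = v})
    -- additionally, `Pr[G_{ρ_J} = 0 | E] ≤ 10/n²`
    (hG : cprEvt p {ω | G (ρ ω (J ω)) ω = false} (E1 ∩ E2) ≤ 10 / (n : ℝ) ^ 2) :
    ∑ z : κ × (Fin l → Option (Fin m)) × (Fin l → Option Bool) × (Fin l → Option Bool) ×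
        (Fin l → Option α) × Fin l, ∑ q : Fin m,
      cprEvt p ({ω | Zvar S M B G ρ J ω = z} ∩ {ω | ρ ω (J ω) = q})
          ({ω | G (ρ ω (J ω)) ω = true} ∩ (E1 ∩ E2)) *
        ∑ x : α,
          |cprEvt p {ω | S q ω = x}
              ({ω | Zvar S M B G ρ J ω = z} ∩ {ω | ρ ω (J ω) = q} ∩
                ({ω | G (ρ ω (J ω)) ω = true} ∩ (E1 ∩ E2))) -
            prEvt p {ω | S q ω = x}|
      ≤ 5 * Real.sqrt (((C : ℝ) + l) / m) + 200 / (n : ℝ) ^ 2 := by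
  have hg0 := prEvt_nonneg p hp ({ω | G (ρ ω (J ω)) ω = true} ∩ (E1 ∩ E2))
  have hRHS : 0 ≤ 5 * Real.sqrt (((C : ℝ) + l) / m) + 200 / (n : ℝ) ^ 2 := by positivity
  rcases hg0.eq_or_lt with hg | hg
  · refine le_trans (le_of_eq ?_) hRHS
    refine Finset.sum_eq_zero fun z _ => Finset.sum_eq_zero fun q _ => ?_
    rw [cprEvt, ← hg, div_zero, zero_mul]
  let μ : Fin m → α → ℝ := fun q x => prEvt p {ω | S q ω = x}
  have hμ : ∀ i x, 0 ≤ μ i x := fun i x => prEvt_nonneg p hp _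
  have hμ1 : ∀ i, ∑ x, μ i x = 1 := by
    intro i
    have := prEvt_sum_fiber p (S i) Set.univ
    simp only [Set.inter_univ] at this
    simp only [μ]
    rw [this]
    simp [prEvt, hsum]
  obtain ⟨σ, hσ, hA⟩ := stepA p hp (Zvar S M B G ρ J) (fun ω => ρ ω (J ω)) S μ
    ({ω | G (ρ ω (J ω)) ω = true} ∩ (E1 ∩ E2)) hg
  have hcent := abs_cent_le μ hμ hμ1 σ hσ
  set X := ∑ z : κ × (Fin l → Option (Fin m)) × (Fin l → Option Bool) × (Fin l → Option Bool) ×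
        (Fin l → Option α) × Fin l, ∑ q : Fin m,
      cprEvt p ({ω | Zvar S M B G ρ J ω = z} ∩ {ω | ρ ω (J ω) = q})
          ({ω | G (ρ ω (J ω)) ω = true} ∩ (E1 ∩ E2)) *
        ∑ x : α,
          |cprEvt p {ω | S q ω = x}
              ({ω | Zvar S M B G ρ J ω = z} ∩ {ω | ρ ω (J ω) = q} ∩
                ({ω | G (ρ ω (J ω)) ω = true} ∩ (E1 ∩ E2))) -
            prEvt p {ω | S q ω = x}| with hX
  set g := prEvt p ({ω | G (ρ ω (J ω)) ω = true} ∩ (E1 ∩ E2)) with hgdef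
  have hXA : X * g = ∑ ω, (if ω ∈ {ω | G (ρ ω (J ω)) ω = true} ∩ (E1 ∩ E2) then p ω else 0) *
      cent μ σ (Zvar S M B G ρ J ω) (ρ ω (J ω)) (S (ρ ω (J ω)) ω) := by
    refine hA.trans (Finset.sum_congr rfl fun ω _ => ?_)
    congr!
  have hX2 : X ≤ 2 := by
    refine le_of_mul_le_mul_right ?_ hg
    rw [hXA, hgdef, prEvt, Finset.mul_sum]
    refine Finset.sum_le_sum fun ω _ => ?_
    have := (abs_le.1 (hcent (Zvar S M B G ρ J ω) (ρ ω (J ω)) (S (ρ ω (J ω)) ω))).2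
    have := hp ω
    by_cases h : ω ∈ {ω | G (ρ ω (J ω)) ω = true} ∩ (E1 ∩ E2)
    · simp only [h, if_true]; nlinarith
    · simp only [h, if_false]; simp
  set y := Real.sqrt (((C : ℝ) + l) / m) with hy
  have hn2 : 0 ≤ 200 / (n : ℝ) ^ 2 := by positivity
  have hnpos : (0 : ℝ) < n := by exact_mod_cast hn
  by_cases hyb : 2 / 5 ≤ y
  · linarith
  push Not at hyb
  have hm : (0 : ℝ) < m := by
    have : 0 < m := by omega
    exact_mod_cast this
  have hy0 : 0 < y := Real.sqrt_pos.2 (by positivity)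
  have hy2 : y ^ 2 * m = (C : ℝ) + l := by
    rw [hy, Real.sq_sqrt (by positivity)]
    field_simp
  by_cases hnb : n ≤ 10
  · have h1 : (n : ℝ) ≤ 10 := by exact_mod_cast hnb
    have h2 : (2 : ℝ) ≤ 200 / (n : ℝ) ^ 2 := by
      rw [le_div_iff₀ (by positivity)]; nlinarith
    linarith
  push Not at hnb
  have h11 : (11 : ℝ) ≤ n := by exact_mod_cast hnb
  set ε : ℝ := 10 / (n : ℝ) ^ 2 with hε
  have hε0 : 0 ≤ ε := by positivity
  have hε1 : ε ≤ 10 / 121 := by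
    rw [hε]
    exact div_le_div_of_nonneg_left (by norm_num) (by norm_num) (by nlinarith)
  have hε200 : 200 / (n : ℝ) ^ 2 = 20 * ε := by rw [hε]; ring
  have hE1' : prEvt p E1 ≤ 10 / 9 * prEvt p (E1 ∩ E2) := by
    rcases (prEvt_nonneg p hp E1).eq_or_lt with h | h
    · rw [← h]
      have := prEvt_nonneg p hp (E1 ∩ E2)
      positivity
    · rw [cprEvt, le_div_iff₀ h, Set.inter_comm] at hE2
      linarith
  have hB := stepB p hp hsum m l C hl1 hlm hC S μ hμ hμ1 E1
    (fun f => by rw [hE1indep f, hSindep f]) M hM E2 hE1' B G ρ J hρinj _ hρJunif hρJindep σ hσ y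
    hy0 (by linarith) hy2
  set e := prEvt p (E1 ∩ E2) with he
  have hge : g ≤ e := prEvt_mono p hp Set.inter_subset_right
  have he0 : 0 < e := lt_of_lt_of_le hg hge
  set bad := prEvt p ({ω | G (ρ ω (J ω)) ω = false} ∩ (E1 ∩ E2)) with hbad
  have hbe : bad ≤ ε * e := by
    rw [cprEvt, div_le_iff₀ he0] at hG
    exact hG
  have hsplit : g + bad = e := by
    rw [hgdef, hbad, he, prEvt, prEvt, prEvt, ← Finset.sum_add_distrib]
    refine Finset.sum_congr rfl fun ω _ => ?_
    by_cases h1 : ω ∈ E1 <;> by_cases h2 : ω ∈ E2 <;> cases h3 : G (ρ ω (J ω)) ω <;>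
      simp [h1, h2, h3]
  have hXg : X * g ≤ e * ((2 * Real.log 4 + 1) * y) + 2 * bad := by
    rw [hXA]
    refine le_trans ?_ (add_le_add_left hB _)
    rw [hbad, prEvt, Finset.mul_sum, ← Finset.sum_add_distrib]
    refine Finset.sum_le_sum fun ω _ => ?_
    have := (abs_le.1 (hcent (Zvar S M B G ρ J ω) (ρ ω (J ω)) (S (ρ ω (J ω)) ω))).1
    have := hp ω
    generalize cent μ σ (Zvar S M B G ρ J ω) (ρ ω (J ω)) (S (ρ ω (J ω)) ω) = v at *
    by_cases h12 : ω ∈ E1 ∩ E2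
    · rcases Bool.eq_false_or_eq_true (G (ρ ω (J ω)) ω) with h3 | h3
      · have ha : ω ∈ {ω | G (ρ ω (J ω)) ω = true} ∩ (E1 ∩ E2) := ⟨h3, h12⟩
        have hb : ω ∉ {ω | G (ρ ω (J ω)) ω = false} ∩ (E1 ∩ E2) := fun h => by
          have h4 : G (ρ ω (J ω)) ω = false := h.1
          rw [h3] at h4; cases h4
        rw [if_pos ha, if_neg hb, if_pos h12]; linarith
      · have ha : ω ∉ {ω | G (ρ ω (J ω)) ω = true} ∩ (E1 ∩ E2) := fun h => by
          have h4 : G (ρ ω (J ω)) ω = true := h.1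
          rw [h3] at h4; cases h4
        have hb : ω ∈ {ω | G (ρ ω (J ω)) ω = false} ∩ (E1 ∩ E2) := ⟨h3, h12⟩
        rw [if_neg ha, if_pos hb, if_pos h12]; nlinarith
    · rw [if_neg (fun h => h12 h.2), if_neg h12, if_neg (fun h => h12 h.2)]; linarith
  have hlog4 : Real.log 4 ≤ 1.3864 := by
    have : Real.log 4 = 2 * Real.log 2 := by
      rw [show (4 : ℝ) = 2 ^ 2 by norm_num, Real.log_pow]; norm_num
    have := Real.log_two_lt_d9
    linarith
  have hb : (2 * Real.log 4 + 1) * y ≤ 3.78 * y := by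
    refine mul_le_mul_of_nonneg_right ?_ hy0.le
    linarith
  have hgl : e ≤ 121 / 111 * g := by nlinarith
  rw [hε200]
  refine le_of_mul_le_mul_right (hXg.trans ?_) hg
  have h5 : e * ((2 * Real.log 4 + 1) * y) + 2 * bad ≤ e * (3.78 * y + 2 * ε) := by
    nlinarith [mul_le_mul_of_nonneg_left hb he0.le]
  have h6 : e * (3.78 * y + 2 * ε) ≤ 121 / 111 * g * (3.78 * y + 2 * ε) :=
    mul_le_mul_of_nonneg_right hgl (by positivity)
  nlinarith [mul_nonneg hg.le hy0.le, mul_nonneg hg.le hε0]
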